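/- Let (Ω, μ) and (Ω', ν) be σ-finite measure spaces, let 1 ≤ p₀, p₁, q₀, q₁ < ∞, let θ ∈ (0,1), and define p and q by 1/p = (1−θ)/p₀ + θ/p₁ and 1/q = (1−θ)/q₀ + θ/q₁. Let T₀ : L^{p₀}(μ; ℂ) → L^{q₀}(ν; ℂ) be a compact linear operator and T₁ : L^{p₁}(μ; ℂ) → L^{q₁}(ν; ℂ) a bounded linear operator which are consistent, in the sense that T₀f = T₁f almost everywhere whenever f ∈ L^{p₀}(μ) ∩ L^{p₁}(μ). Then there exists a compact linear operator S : L^{p}(μ; ℂ) → L^{q}(ν; ℂ) such that Sf = T₀f almost everywhere for every f ∈ L^{p}(μ) ∩ L^{p₀}(μ) ∩ L^{p₁}(μ). -/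

import Mathlib

open MeasureTheory Filter Topology

/-- The complex number with the phase of `a` and modulus `‖a‖ ^ w`, read as `0` for `a = 0`. -/
noncomputable def phasePow (a w : ℂ) : ℂ := a / ‖a‖ * (‖a‖ : ℂ) ^ w

lemma phasePow_zero_left (w : ℂ) : phasePow 0 w = 0 := by simp [phasePow]

lemma phasePow_one (a : ℂ) : phasePow a 1 = a := by
  rcases eq_or_ne a 0 with rfl | ha
  · exact phasePow_zero_left 1
  · have : (‖a‖ : ℂ) ≠ 0 := by simpa using ha
    simp [phasePow, this]

lemma norm_phasePow_le (a w : ℂ) : ‖phasePow a w‖ ≤ ‖a‖ ^ w.re := by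
  rcases eq_or_ne a 0 with rfl | ha
  · rw [phasePow_zero_left, norm_zero]; positivity
  · have h : 0 < ‖a‖ := norm_pos_iff.2 ha
    rw [phasePow, norm_mul, Complex.norm_cpow_eq_rpow_re_of_pos h, norm_div]
    simp [h.ne']

lemma norm_phasePow_eq_of_re_eq (a : ℂ) {w w' : ℂ} (h : w.re = w'.re) :
    ‖phasePow a w‖ = ‖phasePow a w'‖ := by
  rcases eq_or_ne a 0 with rfl | ha
  · simp [phasePow_zero_left]
  · have h' : 0 < ‖a‖ := norm_pos_iff.2 ha
    simp only [phasePow, norm_mul, Complex.norm_cpow_eq_rpow_re_of_pos h', h]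

lemma phasePow_conj_mul_self (u : ℂ) {q : ℝ} (hq : q ≠ 0) :
    phasePow (starRingEnd ℂ u) ((q : ℂ) - 1) * u = ((‖u‖ ^ q : ℝ) : ℂ) := by
  rcases eq_or_ne u 0 with rfl | hu
  · simp [Real.zero_rpow hq]
  · have h : (‖u‖ : ℂ) ≠ 0 := by simpa using hu
    have h2 : (starRingEnd ℂ u) * u = (‖u‖ : ℂ) ^ 2 := Complex.conj_mul' u
    rw [phasePow, RCLike.norm_conj, Complex.cpow_sub _ _ h, Complex.cpow_one,
      Complex.ofReal_cpow (norm_nonneg u)]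
    field_simp
    linear_combination ((‖u‖ : ℂ) ^ (q : ℂ)) * h2

lemma differentiable_phasePow (a : ℂ) {w : ℂ → ℂ} (hw : Differentiable ℂ w) :
    Differentiable ℂ fun z ↦ phasePow a (w z) := by
  rcases eq_or_ne a 0 with rfl | ha
  · simp [phasePow_zero_left]
  · have h : (‖a‖ : ℂ) ≠ 0 := by simpa using ha
    intro z
    exact ((hw z).const_cpow (Or.inl h)).const_mul _

/-- Hölder bound for a bilinear form given by a matrix bounded from weighted `ℓ^r` to weighted
`ℓ^s`, on vectors that are dominated by powers of `a` and `u`. -/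
lemma norm_sum_le_of_matrix_bound {ι κ : Type*} (I : Finset ι) (J : Finset κ)
    (w : ι → ℝ) (v : κ → ℝ) (m : κ → ι → ℂ) (hw : ∀ i, 0 ≤ w i) (hv : ∀ j, 0 ≤ v j)
    {p q r s M : ℝ} (hr : 1 ≤ r) (hs : 1 ≤ s) (hM : 0 ≤ M)
    (H : ∀ a : ι → ℂ, (∑ j ∈ J, v j * ‖∑ i ∈ I, m j i * a i‖ ^ s) ^ s⁻¹ ≤
      M * (∑ i ∈ I, w i * ‖a i‖ ^ r) ^ r⁻¹)
    (a b : ι → ℂ) (u g : κ → ℂ) (hb : ∀ i, ‖b i‖ ≤ ‖a i‖ ^ (p * r⁻¹))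
    (hg : ∀ j, ‖g j‖ ≤ ‖u j‖ ^ (q * (1 - s⁻¹))) (hg0 : ∀ j, u j = 0 → g j = 0) :
    ‖∑ j ∈ J, v j * g j * ∑ i ∈ I, m j i * b i‖ ≤
      M * (∑ i ∈ I, w i * ‖a i‖ ^ p) ^ r⁻¹ * (∑ j ∈ J, v j * ‖u j‖ ^ q) ^ (1 - s⁻¹) := by
  have hr0 : 0 < r := by linarith
  have hs0 : 0 < s := by linarith
  set U : κ → ℂ := fun j ↦ ∑ i ∈ I, m j i * b i with hU
  have hterm : ∀ j, ‖v j * g j * U j‖ ≤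
      (v j * ‖u j‖ ^ q) * (‖U j‖ * ‖u j‖ ^ (-(q * s⁻¹))) := by
    intro j
    rcases eq_or_ne (u j) 0 with h0 | h0
    · rw [hg0 j h0]
      simp only [mul_zero, zero_mul, norm_zero]
      have := hv j
      positivity
    · have hpos : 0 < ‖u j‖ := norm_pos_iff.2 h0
      calc ‖v j * g j * U j‖ = v j * ‖g j‖ * ‖U j‖ := by
            simp [abs_of_nonneg (hv j)]
        _ ≤ v j * ‖u j‖ ^ (q * (1 - s⁻¹)) * ‖U j‖ := by
            gcongr
            · exact hv j
            · exact hg j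
        _ = _ := by
            rw [show q * (1 - s⁻¹) = q + -(q * s⁻¹) by ring, Real.rpow_add hpos]; ring
  have hterm2 : ∀ j, (v j * ‖u j‖ ^ q) * (‖U j‖ * ‖u j‖ ^ (-(q * s⁻¹))) ^ s ≤
      v j * ‖U j‖ ^ s := by
    intro j
    have hvj := hv j
    rw [Real.mul_rpow (by positivity) (by positivity), ← Real.rpow_mul (by positivity),
      show -(q * s⁻¹) * s = -q by field_simp]
    have hle : ‖u j‖ ^ q * ‖u j‖ ^ (-q) ≤ 1 := by
      rw [Real.rpow_neg (by positivity)]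
      exact mul_inv_le_one
    calc _ = (v j * ‖U j‖ ^ s) * (‖u j‖ ^ q * ‖u j‖ ^ (-q)) := by ring
      _ ≤ (v j * ‖U j‖ ^ s) * 1 := by gcongr
      _ = _ := mul_one _
  have hsum : ∀ j, 0 ≤ v j * ‖u j‖ ^ q := fun j ↦ mul_nonneg (hv j) (by positivity)
  calc ‖∑ j ∈ J, v j * g j * U j‖
      ≤ ∑ j ∈ J, (v j * ‖u j‖ ^ q) * (‖U j‖ * ‖u j‖ ^ (-(q * s⁻¹))) :=
        norm_sum_le_of_le _ fun j _ ↦ hterm j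
    _ ≤ (∑ j ∈ J, v j * ‖u j‖ ^ q) ^ (1 - s⁻¹) *
          (∑ j ∈ J, (v j * ‖u j‖ ^ q) * (‖U j‖ * ‖u j‖ ^ (-(q * s⁻¹))) ^ s) ^ s⁻¹ :=
        Real.inner_le_weight_mul_Lp_of_nonneg J hs _ _ hsum fun j ↦ by positivity
    _ ≤ (∑ j ∈ J, v j * ‖u j‖ ^ q) ^ (1 - s⁻¹) * (∑ j ∈ J, v j * ‖U j‖ ^ s) ^ s⁻¹ := by
        have : 0 ≤ ∑ j ∈ J, v j * ‖u j‖ ^ q := Finset.sum_nonneg fun j _ ↦ hsum j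
        refine mul_le_mul_of_nonneg_left (Real.rpow_le_rpow ?_ ?_ (by positivity)) (by positivity)
        · exact Finset.sum_nonneg fun j _ ↦ mul_nonneg (hsum j) (by positivity)
        · exact Finset.sum_le_sum fun j _ ↦ hterm2 j
    _ ≤ (∑ j ∈ J, v j * ‖u j‖ ^ q) ^ (1 - s⁻¹) *
          (M * (∑ i ∈ I, w i * ‖b i‖ ^ r) ^ r⁻¹) := by
        have : 0 ≤ ∑ j ∈ J, v j * ‖u j‖ ^ q := Finset.sum_nonneg fun j _ ↦ hsum j
        gcongr
        exact H b
    _ ≤ (∑ j ∈ J, v j * ‖u j‖ ^ q) ^ (1 - s⁻¹) *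
          (M * (∑ i ∈ I, w i * ‖a i‖ ^ p) ^ r⁻¹) := by
        have : 0 ≤ ∑ j ∈ J, v j * ‖u j‖ ^ q := Finset.sum_nonneg fun j _ ↦ hsum j
        gcongr with i
        · exact Finset.sum_nonneg fun i _ ↦ mul_nonneg (hw i) (by positivity)
        · exact hw i
        · calc ‖b i‖ ^ r ≤ (‖a i‖ ^ (p * r⁻¹)) ^ r := by gcongr; exact hb i
            _ = ‖a i‖ ^ p := by
              rw [← Real.rpow_mul (norm_nonneg _)]; congr 1; field_simp
    _ = _ := by ring

open Complex.HadamardThreeLines in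
/-- Riesz–Thorin interpolation for matrices between weighted `ℓ^p` spaces. -/
theorem matrix_riesz_thorin {ι κ : Type*} (I : Finset ι) (J : Finset κ)
    (w : ι → ℝ) (v : κ → ℝ) (m : κ → ι → ℂ) (hw : ∀ i, 0 ≤ w i) (hv : ∀ j, 0 ≤ v j)
    {p₀ p₁ q₀ q₁ p q θ M₀ M₁ : ℝ}
    (hp₀ : 1 ≤ p₀) (hp₁ : 1 ≤ p₁) (hq₀ : 1 ≤ q₀) (hq₁ : 1 ≤ q₁)
    (hθ0 : 0 < θ) (hθ1 : θ < 1)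
    (hp : 1 / p = (1 - θ) / p₀ + θ / p₁) (hq : 1 / q = (1 - θ) / q₀ + θ / q₁)
    (hp1 : 1 ≤ p) (hq1 : 1 ≤ q) (hM₀ : 0 ≤ M₀) (hM₁ : 0 ≤ M₁)
    (H₀ : ∀ a : ι → ℂ, (∑ j ∈ J, v j * ‖∑ i ∈ I, m j i * a i‖ ^ q₀) ^ q₀⁻¹ ≤
      M₀ * (∑ i ∈ I, w i * ‖a i‖ ^ p₀) ^ p₀⁻¹)
    (H₁ : ∀ a : ι → ℂ, (∑ j ∈ J, v j * ‖∑ i ∈ I, m j i * a i‖ ^ q₁) ^ q₁⁻¹ ≤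
      M₁ * (∑ i ∈ I, w i * ‖a i‖ ^ p₁) ^ p₁⁻¹)
    (a : ι → ℂ) :
    (∑ j ∈ J, v j * ‖∑ i ∈ I, m j i * a i‖ ^ q) ^ q⁻¹ ≤
      M₀ ^ (1 - θ) * M₁ ^ θ * (∑ i ∈ I, w i * ‖a i‖ ^ p) ^ p⁻¹ := by
  have hp0 : 0 < p := by linarith
  have hq0 : 0 < q := by linarith
  set u : κ → ℂ := fun j ↦ ∑ i ∈ I, m j i * a i with hu
  set A := ∑ i ∈ I, w i * ‖a i‖ ^ p with hA
  set B := ∑ j ∈ J, v j * ‖u j‖ ^ q with hB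
  have hA0 : 0 ≤ A := Finset.sum_nonneg fun i _ ↦ mul_nonneg (hw i) (by positivity)
  have hB0 : 0 ≤ B := Finset.sum_nonneg fun j _ ↦ mul_nonneg (hv j) (by positivity)
  let x : ℂ → ℂ := fun z ↦ p * ((1 - z) * (p₀⁻¹ : ℝ) + z * (p₁⁻¹ : ℝ))
  let y : ℂ → ℂ := fun z ↦ q * (1 - ((1 - z) * (q₀⁻¹ : ℝ) + z * (q₁⁻¹ : ℝ)))
  have hxd : Differentiable ℂ x := by fun_prop
  have hyd : Differentiable ℂ y := by fun_prop
  have hxre : ∀ z, (x z).re = p * ((1 - z.re) * p₀⁻¹ + z.re * p₁⁻¹) := fun z ↦ by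
    simp only [x, Complex.re_ofReal_mul, Complex.add_re, Complex.re_mul_ofReal, Complex.sub_re,
      Complex.one_re]
  have hyre : ∀ z, (y z).re = q * (1 - ((1 - z.re) * q₀⁻¹ + z.re * q₁⁻¹)) := fun z ↦ by
    simp only [y, Complex.re_ofReal_mul, Complex.add_re, Complex.re_mul_ofReal, Complex.sub_re,
      Complex.one_re]
  let b : ℂ → ι → ℂ := fun z i ↦ phasePow (a i) (x z)
  let g : ℂ → κ → ℂ := fun z j ↦ phasePow (starRingEnd ℂ (u j)) (y z)
  let Φ : ℂ → ℂ := fun z ↦ ∑ j ∈ J, v j * g z j * ∑ i ∈ I, m j i * b z i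
  have hbd : ∀ i, Differentiable ℂ fun z ↦ b z i := fun i ↦ differentiable_phasePow _ hxd
  have hgd : ∀ j, Differentiable ℂ fun z ↦ g z j := fun j ↦ differentiable_phasePow _ hyd
  have hΦd : Differentiable ℂ Φ := by
    refine Differentiable.fun_sum fun j _ ↦ ((hgd j).const_mul _).mul ?_
    exact Differentiable.fun_sum fun i _ ↦ (hbd i).const_mul _
  have hbn : ∀ z i, ‖b z i‖ ≤ ‖a i‖ ^ (x z).re := fun z i ↦ norm_phasePow_le _ _
  have hgn : ∀ z j, ‖g z j‖ ≤ ‖u j‖ ^ (y z).re := fun z j ↦ by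
    simpa using norm_phasePow_le (starRingEnd ℂ (u j)) (y z)
  have hg0 : ∀ z j, u j = 0 → g z j = 0 := fun z j h ↦ by
    simp only [g, h, map_zero, phasePow_zero_left]
  have hbdd : BddAbove ((norm ∘ Φ) '' verticalClosedStrip 0 1) := by
    let G : ℝ → ℝ := fun t ↦ ∑ j ∈ J, v j * ‖g t j‖ * ∑ i ∈ I, ‖m j i‖ * ‖b t i‖
    have hG : Continuous G := by
      refine continuous_finsetSum _ fun j _ ↦ (continuous_const.mul ?_).mul ?_
      · exact ((hgd j).continuous.comp Complex.continuous_ofReal).norm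
      · exact continuous_finsetSum _ fun i _ ↦ continuous_const.mul
          ((hbd i).continuous.comp Complex.continuous_ofReal).norm
    obtain ⟨C, hC⟩ := (isCompact_Icc (a := (0 : ℝ)) (b := 1)).bddAbove_image hG.continuousOn
    refine ⟨C, ?_⟩
    rintro _ ⟨z, hz, rfl⟩
    refine le_trans ?_ (hC ⟨z.re, hz, rfl⟩)
    refine norm_sum_le_of_le _ fun j _ ↦ ?_
    rw [norm_mul, norm_mul, Complex.norm_real, Real.norm_of_nonneg (hv j),
      norm_phasePow_eq_of_re_eq (w' := y z.re) _ (by simp only [hyre, Complex.ofReal_re])]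
    have := hv j
    gcongr
    refine norm_sum_le_of_le _ fun i _ ↦ ?_
    rw [norm_mul,
      norm_phasePow_eq_of_re_eq (w' := x z.re) _ (by simp only [hxre, Complex.ofReal_re])]
  have key := norm_le_interp_of_mem_verticalClosedStrip₀₁' Φ (z := θ)
    (a := M₀ * A ^ p₀⁻¹ * B ^ (1 - q₀⁻¹)) (b := M₁ * A ^ p₁⁻¹ * B ^ (1 - q₁⁻¹))
    ⟨by simpa using hθ0.le, by simpa using hθ1.le⟩ hΦd.diffContOnCl hbdd
    (fun z hz ↦ by
      have hz : z.re = 0 := hz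
      refine norm_sum_le_of_matrix_bound I J w v m hw hv hp₀ hq₀ hM₀ H₀ a (b z) u (g z)
        (fun i ↦ ?_) (fun j ↦ ?_) (hg0 z)
      · simpa [hxre, hz] using hbn z i
      · simpa [hyre, hz] using hgn z j)
    (fun z hz ↦ by
      have hz : z.re = 1 := hz
      refine norm_sum_le_of_matrix_bound I J w v m hw hv hp₁ hq₁ hM₁ H₁ a (b z) u (g z)
        (fun i ↦ ?_) (fun j ↦ ?_) (hg0 z)
      · simpa [hxre, hz] using hbn z i
      · simpa [hyre, hz] using hgn z j)
  have hp' : (1 - θ) * p₀⁻¹ + θ * p₁⁻¹ = p⁻¹ := by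
    rw [← one_div p, hp]; ring
  have hq' : (1 - θ) * q₀⁻¹ + θ * q₁⁻¹ = q⁻¹ := by
    rw [← one_div q, hq]; ring
  have hxθ : x θ = 1 := by
    have : x θ = ((p * ((1 - θ) * p₀⁻¹ + θ * p₁⁻¹) : ℝ) : ℂ) := by simp [x]
    rw [this, hp', mul_inv_cancel₀ hp0.ne', Complex.ofReal_one]
  have hyθ : y θ = q - 1 := by
    have : y θ = ((q * (1 - ((1 - θ) * q₀⁻¹ + θ * q₁⁻¹)) : ℝ) : ℂ) := by simp [y]
    rw [this, hq', mul_sub, mul_inv_cancel₀ hq0.ne']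
    simp
  have hΦθ : Φ θ = (B : ℂ) := by
    simp only [Φ, b, g, hxθ, hyθ, phasePow_one, hB, Complex.ofReal_sum, Complex.ofReal_mul]
    refine Finset.sum_congr rfl fun j _ ↦ ?_
    rw [mul_assoc, phasePow_conj_mul_self (u j) hq0.ne']
  rw [hΦθ, Complex.norm_real, Real.norm_of_nonneg hB0, Complex.ofReal_re] at key
  have hi₀ : 0 ≤ 1 - q₀⁻¹ := sub_nonneg.2 (inv_le_one_of_one_le₀ hq₀)
  have hi₁ : 0 ≤ 1 - q₁⁻¹ := sub_nonneg.2 (inv_le_one_of_one_le₀ hq₁)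
  have h1θ : 0 ≤ 1 - θ := by linarith
  have hj₀ : 0 ≤ p₀⁻¹ := by positivity
  have hj₁ : 0 ≤ p₁⁻¹ := by positivity
  have hrhs : (M₀ * A ^ p₀⁻¹ * B ^ (1 - q₀⁻¹)) ^ (1 - θ) * (M₁ * A ^ p₁⁻¹ * B ^ (1 - q₁⁻¹)) ^ θ
      = M₀ ^ (1 - θ) * M₁ ^ θ * A ^ p⁻¹ * B ^ (1 - q⁻¹) := by
    rw [show p⁻¹ = p₀⁻¹ * (1 - θ) + p₁⁻¹ * θ by rw [← hp']; ring,
      show 1 - q⁻¹ = (1 - q₀⁻¹) * (1 - θ) + (1 - q₁⁻¹) * θ by rw [← hq']; ring,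
      Real.rpow_add_of_nonneg hA0 (by positivity) (by positivity),
      Real.rpow_add_of_nonneg hB0 (by positivity) (by positivity),
      Real.mul_rpow (by positivity) (by positivity), Real.mul_rpow (by positivity) (by positivity),
      Real.mul_rpow (by positivity) (by positivity), Real.mul_rpow (by positivity) (by positivity)]
    simp only [← Real.rpow_mul hA0, ← Real.rpow_mul hB0]
    ring
  rw [hrhs] at key
  rcases hB0.eq_or_lt with h | h
  · rw [← h, Real.zero_rpow (by positivity)]; positivity
  · have h1 : B = B ^ q⁻¹ * B ^ (1 - q⁻¹) := by
      rw [← Real.rpow_add h]; simp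
    exact le_of_mul_le_mul_right (h1.symm.le.trans key) (by positivity)

section SimpleAverage

variable {β E : Type*} [MeasurableSpace β] {ν : Measure β}

open scoped ENNReal

/-- The `L^p` norm of a simple function that factors through another simple function. -/
lemma eLpNorm_simpleFunc_map (φ : SimpleFunc β E) (g : E → ℂ) {p : ℝ} (hp : 1 ≤ p)
    (hg : ∀ c, ν (φ ⁻¹' {c}) = ∞ → g c = 0) :
    eLpNorm (φ.map g) (ENNReal.ofReal p) ν =
      ENNReal.ofReal ((∑ c ∈ φ.range, ν.real (φ ⁻¹' {c}) * ‖g c‖ ^ p) ^ p⁻¹) := by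
  have hp0 : 0 < p := by linarith
  have hcell : ∀ c, 0 ≤ ν.real (φ ⁻¹' {c}) * ‖g c‖ ^ p := fun c ↦ by positivity
  rw [eLpNorm_eq_lintegral_rpow_enorm_toReal (by simpa using hp0) ENNReal.ofReal_ne_top,
    ENNReal.toReal_ofReal hp0.le, one_div,
    ← ENNReal.ofReal_rpow_of_nonneg (Finset.sum_nonneg fun c _ ↦ hcell c) (by positivity),
    ENNReal.ofReal_sum_of_nonneg fun c _ ↦ hcell c]
  congr 1
  have : (fun x ↦ ‖φ.map g x‖ₑ ^ p) = φ.map fun c ↦ ‖g c‖ₑ ^ p := by ext x; simp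
  rw [this, SimpleFunc.lintegral_eq_lintegral, SimpleFunc.map_lintegral]
  refine Finset.sum_congr rfl fun c _ ↦ ?_
  by_cases hc : ν (φ ⁻¹' {c}) = ∞
  · simp [hg c hc, hp0, hp0.ne']
  · rw [ENNReal.ofReal_mul (by positivity), ofReal_measureReal hc, mul_comm,
      ← ENNReal.ofReal_rpow_of_nonneg (norm_nonneg _) hp0.le, ofReal_norm]

lemma setAverage_eq_zero_of_measure_eq_top (f : β → ℂ) {s : Set β} (hs : ν s = ∞) :
    ⨍ y in s, f y ∂ν = 0 := by
  simp [setAverage_eq, measureReal_def, hs]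

/-- The average over a set, as a linear functional on `L^q`. -/
noncomputable def setAverageLM (q : ℝ≥0∞) [hq : Fact (1 ≤ q)] (ν : Measure β) (s : Set β) :
    Lp ℂ q ν →ₗ[ℂ] ℂ where
  toFun f := ⨍ y in s, f y ∂ν
  map_add' f g := by
    by_cases hs : ν s = ∞
    · simp [setAverage_eq_zero_of_measure_eq_top _ hs]
    · have : IsFiniteMeasure (ν.restrict s) := isFiniteMeasure_restrict.2 hs
      simp only [setAverage_eq]
      rw [integral_congr_ae (ae_restrict_of_ae (Lp.coeFn_add f g)), ← smul_add]
      congr 1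
      exact integral_add (((Lp.memLp f).restrict s).integrable hq.out)
        (((Lp.memLp g).restrict s).integrable hq.out)
  map_smul' c f := by
    simp only [setAverage_eq, RingHom.id_apply]
    rw [integral_congr_ae (ae_restrict_of_ae (Lp.coeFn_smul c f)), smul_comm c]
    congr 1
    exact integral_smul c _

lemma setAverageLM_apply (q : ℝ≥0∞) [Fact (1 ≤ q)] (s : Set β) (f : Lp ℂ q ν) :
    setAverageLM q ν s f = ⨍ y in s, f y ∂ν := rfl

/-- Replace `f` by its mean on each level set of `φ` (and by `0` on those of infinite measure). -/
noncomputable def simpleAverage (φ : SimpleFunc β E) (ν : Measure β) (f : β → ℂ) : SimpleFunc β ℂ :=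
  φ.map fun c ↦ ⨍ y in φ ⁻¹' {c}, f y ∂ν

lemma simpleAverage_congr (φ : SimpleFunc β E) {f g : β → ℂ} (h : f =ᵐ[ν] g) :
    simpleAverage φ ν f = simpleAverage φ ν g := by
  unfold simpleAverage
  congr 1
  ext c
  simp only [setAverage_eq]
  rw [integral_congr_ae (ae_restrict_of_ae h)]

/-- Jensen's inequality for the mean over a set. -/
lemma enorm_setAverage_rpow_mul_le {f : β → ℂ} (hf : AEStronglyMeasurable f ν) {q : ℝ}
    (hq : 1 ≤ q) (s : Set β) :
    ‖⨍ y in s, f y ∂ν‖ₑ ^ q * ν s ≤ ∫⁻ y in s, ‖f y‖ₑ ^ q ∂ν := by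
  have hq0 : 0 < q := by linarith
  by_cases hs : ν s = ∞
  · simp [setAverage_eq_zero_of_measure_eq_top f hs, hq0]
  by_cases hs0 : ν s = 0
  · simp [hs0]
  have h1 : ‖⨍ y in s, f y ∂ν‖ₑ ≤ (ν s)⁻¹ * ∫⁻ y in s, ‖f y‖ₑ ∂ν := by
    rw [setAverage_eq, enorm_smul]
    gcongr
    · rw [enorm_inv (by simp [measureReal_def, ENNReal.toReal_eq_zero_iff, hs, hs0]),
        Real.enorm_of_nonneg measureReal_nonneg, ofReal_measureReal hs]
    · exact enorm_integral_le_lintegral_enorm _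
  have h2 : ∫⁻ y in s, ‖f y‖ₑ ∂ν ≤
      (∫⁻ y in s, ‖f y‖ₑ ^ q ∂ν) ^ (1 / q) * ν s ^ (1 - 1 / q) := by
    have := eLpNorm_le_eLpNorm_mul_rpow_measure_univ (p := 1) (q := ENNReal.ofReal q)
      (by simpa using hq) (hf.restrict (s := s))
    rwa [eLpNorm_one_eq_lintegral_enorm,
      eLpNorm_eq_lintegral_rpow_enorm_toReal (by simpa using hq0) ENNReal.ofReal_ne_top,
      ENNReal.toReal_ofReal hq0.le, ENNReal.toReal_one, div_one,
      Measure.restrict_apply_univ] at this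
  calc ‖⨍ y in s, f y ∂ν‖ₑ ^ q * ν s
      ≤ ((ν s)⁻¹ * ((∫⁻ y in s, ‖f y‖ₑ ^ q ∂ν) ^ (1 / q) * ν s ^ (1 - 1 / q))) ^ q * ν s := by
        gcongr
        exact h1.trans (by gcongr)
    _ = (∫⁻ y in s, ‖f y‖ₑ ^ q ∂ν) * (ν s ^ (-q) * ν s ^ (q - 1) * ν s ^ (1 : ℝ)) := by
        rw [ENNReal.mul_rpow_of_nonneg _ _ hq0.le, ENNReal.mul_rpow_of_nonneg _ _ hq0.le,
          ← ENNReal.rpow_mul, ← ENNReal.rpow_mul, one_div_mul_cancel hq0.ne', ENNReal.rpow_one,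
          ENNReal.inv_rpow, ← ENNReal.rpow_neg, ENNReal.rpow_one,
          show (1 - 1 / q) * q = q - 1 by field_simp]
        ring
    _ = _ := by
        rw [← ENNReal.rpow_add _ _ hs0 hs, ← ENNReal.rpow_add _ _ hs0 hs]
        ring_nf
        simp

lemma eLpNorm_simpleAverage_le (φ : SimpleFunc β E) {f : β → ℂ} (hf : AEStronglyMeasurable f ν)
    {q : ℝ≥0∞} (hq : 1 ≤ q) (hq' : q ≠ ∞) :
    eLpNorm (simpleAverage φ ν f) q ν ≤ eLpNorm f q ν := by
  have hq0 : q ≠ 0 := (zero_lt_one.trans_le hq).ne'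
  have hq1 : 1 ≤ q.toReal := by
    simpa using (ENNReal.toReal_le_toReal ENNReal.one_ne_top hq').2 hq
  rw [eLpNorm_eq_lintegral_rpow_enorm_toReal hq0 hq',
    eLpNorm_eq_lintegral_rpow_enorm_toReal hq0 hq']
  refine ENNReal.rpow_le_rpow ?_ (by positivity)
  have hmap : (fun x ↦ ‖simpleAverage φ ν f x‖ₑ ^ q.toReal) =
      φ.map fun c ↦ ‖⨍ y in φ ⁻¹' {c}, f y ∂ν‖ₑ ^ q.toReal := by
    ext x; simp [simpleAverage]
  have hU : (⋃ c ∈ φ.range, φ ⁻¹' {c}) = Set.univ := by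
    ext x; simp
  rw [hmap, SimpleFunc.lintegral_eq_lintegral, SimpleFunc.map_lintegral,
    ← setLIntegral_univ fun x ↦ ‖f x‖ₑ ^ q.toReal, ← hU,
    lintegral_biUnion_finset (fun c _ c' _ h ↦ ?_) fun c _ ↦ φ.measurableSet_fiber c]
  · exact Finset.sum_le_sum fun c _ ↦ enorm_setAverage_rpow_mul_le hf hq1 _
  · exact Disjoint.preimage _ (Set.disjoint_singleton.2 h)

lemma memLp_simpleAverage (φ : SimpleFunc β E) {f : β → ℂ} {q : ℝ≥0∞} (hf : MemLp f q ν)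
    (hq : 1 ≤ q) (hq' : q ≠ ∞) : MemLp (simpleAverage φ ν f) q ν :=
  ⟨SimpleFunc.aestronglyMeasurable _,
    (eLpNorm_simpleAverage_le φ hf.aestronglyMeasurable hq hq').trans_lt hf.eLpNorm_lt_top⟩

/-- `simpleAverage` as a contraction of `L^q`. -/
noncomputable def simpleAverageL (φ : SimpleFunc β E) (ν : Measure β) {q : ℝ≥0∞} [hq : Fact (1 ≤ q)]
    (hq' : q ≠ ∞) : Lp ℂ q ν →L[ℂ] Lp ℂ q ν :=
  LinearMap.mkContinuous
    { toFun := fun f ↦ (memLp_simpleAverage φ (Lp.memLp f) hq.out hq').toLp _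
      map_add' := fun f g ↦ by
        rw [← MemLp.toLp_add]
        refine MemLp.toLp_congr _ _ (Eventually.of_forall fun x ↦ ?_)
        exact (setAverageLM q ν (φ ⁻¹' {φ x})).map_add f g
      map_smul' := fun c f ↦ by
        rw [RingHom.id_apply, ← MemLp.toLp_const_smul]
        refine MemLp.toLp_congr _ _ (Eventually.of_forall fun x ↦ ?_)
        exact (setAverageLM q ν (φ ⁻¹' {φ x})).map_smul c f } 1 fun f ↦ by
    rw [one_mul, LinearMap.coe_mk, AddHom.coe_mk, Lp.norm_toLp, Lp.norm_def]
    exact ENNReal.toReal_mono (Lp.eLpNorm_ne_top f)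
      (eLpNorm_simpleAverage_le φ (Lp.aestronglyMeasurable f) hq.out hq')

variable {q : ℝ≥0∞} [hq : Fact (1 ≤ q)] (hq' : q ≠ ∞)

lemma simpleAverageL_apply (φ : SimpleFunc β E) (f : Lp ℂ q ν) :
    simpleAverageL φ ν hq' f = (memLp_simpleAverage φ (Lp.memLp f) hq.out hq').toLp
      (simpleAverage φ ν f) := rfl

lemma coeFn_simpleAverageL (φ : SimpleFunc β E) (f : Lp ℂ q ν) :
    simpleAverageL φ ν hq' f =ᵐ[ν] simpleAverage φ ν f :=
  MemLp.coeFn_toLp (memLp_simpleAverage φ (Lp.memLp f) hq.out hq')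

lemma norm_simpleAverageL_le (φ : SimpleFunc β E) : ‖simpleAverageL φ ν hq'‖ ≤ 1 :=
  LinearMap.mkContinuous_norm_le _ zero_le_one _

lemma norm_simpleAverageL_apply_le (φ : SimpleFunc β E) (f : Lp ℂ q ν) :
    ‖simpleAverageL φ ν hq' f‖ ≤ ‖f‖ := by
  simpa using (simpleAverageL φ ν hq').le_of_opNorm_le (norm_simpleAverageL_le hq' φ) f

lemma isCompactOperator_simpleAverageL (φ : SimpleFunc β E) :
    IsCompactOperator (simpleAverageL φ ν hq') := by
  classical
  let F := φ.range.filter fun c ↦ ν (φ ⁻¹' {c}) ≠ ∞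
  let e : F → Lp ℂ q ν := fun c ↦ indicatorConstLp q (φ.measurableSet_fiber c)
    (Finset.mem_filter.1 c.2).2 1
  let V : Submodule ℂ (Lp ℂ q ν) := Submodule.span ℂ (Set.range e)
  have : FiniteDimensional ℂ V := FiniteDimensional.span_of_finite ℂ (Set.finite_range e)
  have : ProperSpace V := FiniteDimensional.proper ℂ V
  have hmem : ∀ f, simpleAverageL φ ν hq' f ∈ V := by
    intro f
    have : simpleAverageL φ ν hq' f = ∑ c : F, (⨍ y in φ ⁻¹' {c.1}, f y ∂ν) • e c := by
      apply Lp.ext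
      have h1 : ∀ᵐ x ∂ν, ∀ c : F, ((⨍ y in φ ⁻¹' {c.1}, f y ∂ν) • e c : Lp ℂ q ν) x =
          (φ ⁻¹' {c.1}).indicator (fun _ ↦ ⨍ y in φ ⁻¹' {c.1}, f y ∂ν) x := by
        rw [ae_all_iff]
        intro c
        filter_upwards [Lp.coeFn_smul (⨍ y in φ ⁻¹' {c.1}, f y ∂ν) (e c),
          indicatorConstLp_coeFn (p := q) (hs := φ.measurableSet_fiber c.1)
            (hμs := (Finset.mem_filter.1 c.2).2) (c := (1 : ℂ))] with x hx1 hx2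
        rw [hx1, Pi.smul_apply, hx2]
        by_cases h : x ∈ φ ⁻¹' {c.1} <;> simp [h]
      filter_upwards [coeFn_simpleAverageL hq' φ f, h1,
        Lp.coeFn_finsetSum (Finset.univ : Finset F)
          fun c ↦ (⨍ y in φ ⁻¹' {c.1}, f y ∂ν) • e c] with x hx h1x h2x
      rw [hx, h2x, Finset.sum_apply, Finset.sum_congr rfl fun c _ ↦ h1x c]
      by_cases hc : ν (φ ⁻¹' {φ x}) = ∞
      · rw [Finset.sum_eq_zero]
        · simp [simpleAverage, setAverage_eq_zero_of_measure_eq_top _ hc]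
        · intro c _
          refine Set.indicator_of_notMem (fun hx ↦ (Finset.mem_filter.1 c.2).2 ?_) _
          rwa [← (hx : φ x = c.1)]
      · rw [Finset.sum_eq_single ⟨φ x, Finset.mem_filter.2 ⟨φ.mem_range_self x, hc⟩⟩]
        · simp [simpleAverage]
        · intro c _ hne
          have hx : x ∉ φ ⁻¹' {c.1} := fun hx ↦ hne (Subtype.ext (hx : φ x = c.1).symm)
          exact Set.indicator_of_notMem hx _
        · simp
    rw [this]
    exact Submodule.sum_mem _ fun c _ ↦ V.smul_mem _ (Submodule.subset_span ⟨c, rfl⟩)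
  have hcod : IsCompactOperator ((simpleAverageL φ ν hq').codRestrict V hmem) :=
    isCompactOperator_of_locallyCompactSpace_dom _
  exact hcod.clm_comp V.subtypeL

/-- A finite family of simple functions, as a simple function into the product. -/
def simpleFuncPi {κ : Type*} [Finite κ] (s : κ → SimpleFunc β ℂ) : SimpleFunc β (κ → ℂ) where
  toFun x k := s k x
  measurableSet_fiber' c := by
    have : (fun x k ↦ s k x) ⁻¹' {c} = ⋂ k, s k ⁻¹' {c k} := by
      ext x; simp [funext_iff]
    rw [this]
    exact MeasurableSet.iInter fun k ↦ (s k).measurableSet_fiber _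
  finite_range' := by
    refine (Set.Finite.pi' fun k ↦ (s k).finite_range).subset ?_
    rintro _ ⟨x, rfl⟩ k
    exact ⟨x, rfl⟩

/-- Averaging over the level sets of a finite family fixes the integrable members of it. -/
lemma simpleAverage_simpleFuncPi {κ : Type*} [Finite κ] (s : κ → SimpleFunc β ℂ) (k : κ)
    (hq' : q ≠ ∞) (hs : MemLp (s k) q ν) : simpleAverage (simpleFuncPi s) ν (s k) =ᵐ[ν] s k := by
  set φ := simpleFuncPi s with hφ
  have hnull : ∀ᵐ x ∂ν, ν (φ ⁻¹' {φ x}) ≠ 0 := by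
    have : ∀ᵐ x ∂ν, ∀ c ∈ φ.range, ν (φ ⁻¹' {c}) = 0 → x ∉ φ ⁻¹' {c} := by
      rw [Finset.eventually_all]
      intro c _
      by_cases hc : ν (φ ⁻¹' {c}) = 0
      · filter_upwards [measure_eq_zero_iff_ae_notMem.1 hc] with x hx _ using hx
      · exact Eventually.of_forall fun x h ↦ absurd h hc
    filter_upwards [this] with x hx h0
    exact hx (φ x) (φ.mem_range_self x) h0 rfl
  filter_upwards [hnull] with x hx0
  have hconst : ∀ y ∈ φ ⁻¹' {φ x}, s k y = s k x := fun y hy ↦ congrFun (hy : φ y = φ x) k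
  change ⨍ y in φ ⁻¹' {φ x}, s k y ∂ν = s k x
  by_cases hx : ν (φ ⁻¹' {φ x}) = ∞
  · rw [setAverage_eq_zero_of_measure_eq_top _ hx]
    by_contra hne
    refine ((s k).measure_preimage_lt_top_of_memLp (zero_lt_one.trans_le hq.out).ne' hq' hs (s k x)
      (Ne.symm hne)).ne (top_unique (hx ▸ measure_mono hconst))
  · rw [setAverage_congr_fun (g := fun _ ↦ s k x) (φ.measurableSet_fiber _)
      (Eventually.of_forall hconst), setAverage_const hx0 hx]

/-- Finitely many elements of `L^q` are approximated by their averages over a common finite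
partition. -/
lemma exists_norm_sub_simpleAverageL_le {κ : Type*} [Finite κ] (h : κ → Lp ℂ q ν) {ε : ℝ}
    (hε : 0 < ε) : ∃ φ : SimpleFunc β (κ → ℂ), ∀ k, ‖h k - simpleAverageL φ ν hq' (h k)‖ ≤ ε := by
  have hs : ∀ k, ∃ (s : SimpleFunc β ℂ) (hs : MemLp s q ν), ‖h k - hs.toLp s‖ ≤ ε / 2 := by
    intro k
    obtain ⟨s, hs, hsm⟩ := (Lp.memLp (h k)).exists_simpleFunc_eLpNorm_sub_lt hq'
      (ε := ENNReal.ofReal (ε / 2)) (by simpa using hε)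
    refine ⟨s, hsm, ?_⟩
    rw [Lp.norm_def, eLpNorm_congr_ae (g := ⇑(h k) - ⇑s)]
    · exact ENNReal.toReal_le_of_le_ofReal (by positivity) hs.le
    · filter_upwards [Lp.coeFn_sub (h k) (hsm.toLp s), hsm.coeFn_toLp] with x h1 h2
      rw [h1, Pi.sub_apply, h2, Pi.sub_apply]
  choose s hsm hsε using hs
  refine ⟨simpleFuncPi s, fun k ↦ ?_⟩
  set A := simpleAverageL (simpleFuncPi s) ν hq'
  set g := (hsm k).toLp (s k)
  have hfix : A g = g := by
    refine MemLp.toLp_congr (memLp_simpleAverage _ (Lp.memLp g) hq.out hq') (hsm k) ?_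
    rw [simpleAverage_congr _ (hsm k).coeFn_toLp]
    exact simpleAverage_simpleFuncPi s k hq' (hsm k)
  calc ‖h k - A (h k)‖ = ‖(h k - g) - A (h k - g)‖ := by rw [map_sub, hfix]; congr 1; abel
    _ ≤ ‖h k - g‖ + ‖A (h k - g)‖ := norm_sub_le _ _
    _ ≤ ‖h k - g‖ + ‖h k - g‖ := by gcongr; exact norm_simpleAverageL_apply_le hq' _ _
    _ ≤ ε := by linarith [hsε k]

end SimpleAverage

open scoped ENNReal in
/-- A compact operator into `L^q` is approximated in norm by its averages over finite
partitions. -/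
lemma IsCompactOperator.exists_norm_sub_simpleAverageL_comp_le {β : Type*} [MeasurableSpace β]
    {ν : Measure β} {q : ℝ≥0∞} [hq : Fact (1 ≤ q)] (hq' : q ≠ ∞)
    {X : Type*} [NormedAddCommGroup X] [NormedSpace ℂ X] {T : X →L[ℂ] Lp ℂ q ν}
    (hT : IsCompactOperator T) {ε : ℝ} (hε : 0 < ε) :
    ∃ (s : Set (Lp ℂ q ν)) (φ : SimpleFunc β (s → ℂ)),
      ‖T - (simpleAverageL φ ν hq').comp T‖ ≤ ε := by
  have hc : TotallyBounded (T '' Metric.closedBall 0 1) :=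
    (hT.isCompact_closure_image_closedBall (f := T.toLinearMap) 1).totallyBounded.subset
      subset_closure
  obtain ⟨t, ht, hsub⟩ := Metric.totallyBounded_iff.1 hc (ε / 3) (by positivity)
  have : Finite t := ht
  obtain ⟨φ, hφ⟩ := exists_norm_sub_simpleAverageL_le hq' (fun k : t ↦ (k : Lp ℂ q ν))
    (ε := ε / 3) (by positivity)
  refine ⟨t, φ, ContinuousLinearMap.opNorm_le_of_unit_norm hε.le fun x hx ↦ ?_⟩
  obtain ⟨y, hy, hxy⟩ := Set.mem_iUnion₂.1 (hsub (Set.mem_image_of_mem T (x := x) (by simp [hx])))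
  rw [Metric.mem_ball, dist_eq_norm] at hxy
  set A := simpleAverageL φ ν hq'
  calc ‖(T - A.comp T) x‖ = ‖(T x - y) + (y - A y) - A (T x - y)‖ := by
        simp only [sub_apply, ContinuousLinearMap.comp_apply, map_sub]
        congr 1; abel
    _ ≤ ‖T x - y‖ + ‖y - A y‖ + ‖A (T x - y)‖ :=
        (norm_sub_le _ _).trans (by gcongr; exact norm_add_le _ _)
    _ ≤ ‖T x - y‖ + ‖y - A y‖ + ‖T x - y‖ := by
        gcongr; exact norm_simpleAverageL_apply_le hq' _ _
    _ ≤ ε := by linarith [hφ ⟨y, hy⟩]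

section SimpleFunctions

open scoped ENNReal

variable {α β : Type*} [MeasurableSpace α] [MeasurableSpace β] {μ : Measure α} {ν : Measure β}

/-- An interpolated exponent lies between the two endpoint exponents. -/
lemma min_le_and_le_max_of_one_div_eq {q₀ q₁ q θ : ℝ} (hq₀ : 1 ≤ q₀) (hq₁ : 1 ≤ q₁) (hq1 : 1 ≤ q)
    (hθ0 : 0 < θ) (hθ1 : θ < 1) (hq : 1 / q = (1 - θ) / q₀ + θ / q₁) :
    min q₀ q₁ ≤ q ∧ q ≤ max q₀ q₁ := by
  have h0 : 0 < q₀ := by linarith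
  have h1 : 0 < q₁ := by linarith
  have h2 : 0 < q := by linarith
  have hmin : 0 < min q₀ q₁ := lt_min h0 h1
  have hmax : 0 < max q₀ q₁ := lt_max_of_lt_left h0
  have hθ1' : 0 < 1 - θ := by linarith
  constructor
  · rw [← one_div_le_one_div h2 hmin, hq]
    calc (1 - θ) / q₀ + θ / q₁ ≤ (1 - θ) / min q₀ q₁ + θ / min q₀ q₁ := by
          gcongr
          · exact min_le_left _ _
          · exact min_le_right _ _
      _ = _ := by ring
  · rw [← one_div_le_one_div hmax h2, hq]
    calc 1 / max q₀ q₁ = (1 - θ) / max q₀ q₁ + θ / max q₀ q₁ := by ring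
      _ ≤ _ := by
          gcongr
          · exact le_max_left _ _
          · exact le_max_right _ _

lemma memLp_of_memLp_of_min_le_of_le_max {g : β → ℂ} {q₀ q₁ q : ℝ} (hq₀ : 1 ≤ q₀) (hq₁ : 1 ≤ q₁)
    (hmin : min q₀ q₁ ≤ q) (hmax : q ≤ max q₀ q₁) (h₀ : MemLp g (ENNReal.ofReal q₀) ν)
    (h₁ : MemLp g (ENNReal.ofReal q₁) ν) : MemLp g (ENNReal.ofReal q) ν := by
  have hq0 : 0 < q := (lt_min (by linarith) (by linarith)).trans_le hmin
  have hfin : ∀ {r : ℝ}, 0 < r →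
      (MemLp g (ENNReal.ofReal r) ν ↔ AEStronglyMeasurable g ν ∧ ∫⁻ x, ‖g x‖ₑ ^ r ∂ν < ∞) := by
    intro r hr
    rw [MemLp, eLpNorm_lt_top_iff_lintegral_rpow_enorm_lt_top (by simpa using hr)
      ENNReal.ofReal_ne_top, ENNReal.toReal_ofReal hr.le]
  rw [hfin (by linarith)] at h₀ h₁
  rw [hfin hq0]
  refine ⟨h₀.1, lt_of_le_of_lt (lintegral_mono fun x ↦ ?_)
    ((lintegral_add_left' (h₀.1.enorm.pow_const q₀) fun x ↦ ‖g x‖ₑ ^ q₁).trans_lt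
      (ENNReal.add_lt_top.2 ⟨h₀.2, h₁.2⟩))⟩
  rcases le_total ‖g x‖ₑ 1 with hx | hx
  · refine (ENNReal.rpow_le_rpow_of_exponent_ge hx hmin).trans ?_
    rcases min_choice q₀ q₁ with h | h <;> rw [h]
    exacts [le_self_add, le_add_self]
  · refine (ENNReal.rpow_le_rpow_of_exponent_le hx hmax).trans ?_
    rcases max_choice q₀ q₁ with h | h <;> rw [h]
    exacts [le_self_add, le_add_self]

lemma memLp_simpleFunc_exponent {f : SimpleFunc α ℂ} {p : ℝ≥0∞} (r : ℝ≥0∞) (hp0 : p ≠ 0)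
    (hp : p ≠ ∞) (hr0 : r ≠ 0) (hr : r ≠ ∞) (hf : MemLp f p μ) : MemLp f r μ := by
  rw [SimpleFunc.memLp_iff hr0 hr]
  exact (SimpleFunc.memLp_iff hp0 hp).1 hf

open Classical in
/-- Replace `a c` by `0` when the level set `{f = c}` has infinite measure. -/
noncomputable def finiteCut (f : SimpleFunc α ℂ) (μ : Measure α) (a : ℂ → ℂ) (c : ℂ) : ℂ :=
  if μ (f ⁻¹' {c}) = ∞ then 0 else a c

lemma memLp_map_finiteCut (f : SimpleFunc α ℂ) (a : ℂ → ℂ) {p : ℝ} (hp : 1 ≤ p) :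
    MemLp (f.map (finiteCut f μ a)) (ENNReal.ofReal p) μ := by
  refine ⟨SimpleFunc.aestronglyMeasurable _, ?_⟩
  rw [eLpNorm_simpleFunc_map f _ hp fun c hc ↦ by simp [finiteCut, hc]]
  exact ENNReal.ofReal_lt_top

/-- The parametrization of the simple functions that are constant on the level sets of `f`. -/
noncomputable def simpleFuncLM (f : SimpleFunc α ℂ) (μ : Measure α) (p : ℝ)
    [hp : Fact (1 ≤ ENNReal.ofReal p)] : (ℂ → ℂ) →ₗ[ℂ] Lp ℂ (ENNReal.ofReal p) μ where
  toFun a := (memLp_map_finiteCut f a (ENNReal.one_le_ofReal.1 hp.out)).toLp _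
  map_add' a b := by
    rw [← MemLp.toLp_add]
    refine MemLp.toLp_congr _ _ (Eventually.of_forall fun x ↦ ?_)
    by_cases h : μ (f ⁻¹' {f x}) = ∞ <;> simp [finiteCut, h]
  map_smul' c a := by
    rw [RingHom.id_apply, ← MemLp.toLp_const_smul]
    refine MemLp.toLp_congr _ _ (Eventually.of_forall fun x ↦ ?_)
    by_cases h : μ (f ⁻¹' {f x}) = ∞ <;> simp [finiteCut, h]

variable {p₀ p₁ q₀ q₁ p q θ : ℝ} [hp₀ : Fact (1 ≤ ENNReal.ofReal p₀)]
  [hp₁ : Fact (1 ≤ ENNReal.ofReal p₁)] [hq₀ : Fact (1 ≤ ENNReal.ofReal q₀)]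
  [hq₁ : Fact (1 ≤ ENNReal.ofReal q₁)] [hp1 : Fact (1 ≤ ENNReal.ofReal p)]
  [hq1 : Fact (1 ≤ ENNReal.ofReal q)]

lemma coeFn_simpleFuncLM (f : SimpleFunc α ℂ) (a : ℂ → ℂ) :
    simpleFuncLM f μ p a =ᵐ[μ] f.map (finiteCut f μ a) :=
  MemLp.coeFn_toLp (memLp_map_finiteCut f a (ENNReal.one_le_ofReal.1 hp1.out))

lemma norm_simpleFuncLM (f : SimpleFunc α ℂ) (a : ℂ → ℂ) :
    ‖simpleFuncLM f μ p a‖ = (∑ c ∈ f.range, μ.real (f ⁻¹' {c}) * ‖a c‖ ^ p) ^ p⁻¹ := by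
  rw [Lp.norm_def, eLpNorm_congr_ae (coeFn_simpleFuncLM f a),
    eLpNorm_simpleFunc_map f _ (ENNReal.one_le_ofReal.1 hp1.out)
      fun c hc ↦ by simp [finiteCut, hc],
    ENNReal.toReal_ofReal (Real.rpow_nonneg (Finset.sum_nonneg fun c _ ↦ by positivity) _)]
  congr 1
  refine Finset.sum_congr rfl fun c _ ↦ ?_
  by_cases h : μ (f ⁻¹' {c}) = ∞ <;> simp [finiteCut, h, measureReal_def]

lemma simpleFuncLM_eq_sum (f : SimpleFunc α ℂ) (a : ℂ → ℂ) :
    simpleFuncLM f μ p a = ∑ i ∈ f.range, a i • simpleFuncLM f μ p (Pi.single i 1) := by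
  simp_rw [← map_smul]
  rw [← map_sum]
  refine MemLp.toLp_congr (memLp_map_finiteCut f _ (ENNReal.one_le_ofReal.1 hp1.out))
    (memLp_map_finiteCut f _ (ENNReal.one_le_ofReal.1 hp1.out)) (Eventually.of_forall fun x ↦ ?_)
  have : (∑ i ∈ f.range, a i • (Pi.single i 1 : ℂ → ℂ)) (f x) = a (f x) := by
    simp [Finset.sum_apply, Pi.single_apply]
  simp [finiteCut, ← this]

lemma simpleFuncLM_id {f : SimpleFunc α ℂ} (hf : MemLp f (ENNReal.ofReal p) μ) :
    simpleFuncLM f μ p id = hf.toLp f := by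
  refine MemLp.toLp_congr (memLp_map_finiteCut f _ (ENNReal.one_le_ofReal.1 hp1.out)) hf
    (Eventually.of_forall fun x ↦ ?_)
  by_cases h : μ (f ⁻¹' {f x}) = ∞
  · have h0 : f x = 0 := by
      by_contra h0
      exact (f.measure_preimage_lt_top_of_memLp (zero_lt_one.trans_le hp1.out).ne'
        ENNReal.ofReal_ne_top hf _ h0).ne h
    rw [SimpleFunc.coe_map, Function.comp_apply, finiteCut, if_pos h, h0]
  · simp [finiteCut, h]

/-- The matrix of `T` relative to the level sets of `f` and of `φ`. -/
noncomputable def simpleMatrix {E : Type*} (f : SimpleFunc α ℂ) (φ : SimpleFunc β E)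
    (T : Lp ℂ (ENNReal.ofReal p) μ →L[ℂ] Lp ℂ (ENNReal.ofReal q) ν) (j : E) (i : ℂ) : ℂ :=
  setAverageLM (ENNReal.ofReal q) ν (φ ⁻¹' {j}) (T (simpleFuncLM f μ p (Pi.single i 1)))

lemma sum_simpleMatrix_mul {E : Type*} (f : SimpleFunc α ℂ) (φ : SimpleFunc β E)
    (T : Lp ℂ (ENNReal.ofReal p) μ →L[ℂ] Lp ℂ (ENNReal.ofReal q) ν) (a : ℂ → ℂ) (j : E) :
    ∑ i ∈ f.range, simpleMatrix f φ T j i * a i =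
      ⨍ y in φ ⁻¹' {j}, T (simpleFuncLM f μ p a) y ∂ν := by
  rw [← setAverageLM_apply, simpleFuncLM_eq_sum f a, map_sum, map_sum]
  refine Finset.sum_congr rfl fun i _ ↦ ?_
  rw [map_smul, map_smul, smul_eq_mul, mul_comm, simpleMatrix]

lemma eLpNorm_simpleAverage_simpleFuncLM {E : Type*} (f : SimpleFunc α ℂ) (φ : SimpleFunc β E)
    (T : Lp ℂ (ENNReal.ofReal p) μ →L[ℂ] Lp ℂ (ENNReal.ofReal q) ν) (a : ℂ → ℂ) {r : ℝ}
    (hr : 1 ≤ r) :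
    eLpNorm (simpleAverage φ ν (T (simpleFuncLM f μ p a))) (ENNReal.ofReal r) ν =
      ENNReal.ofReal ((∑ j ∈ φ.range, ν.real (φ ⁻¹' {j}) *
        ‖∑ i ∈ f.range, simpleMatrix f φ T j i * a i‖ ^ r) ^ r⁻¹) := by
  simp_rw [sum_simpleMatrix_mul]
  exact eLpNorm_simpleFunc_map φ _ hr fun c hc ↦ setAverage_eq_zero_of_measure_eq_top _ hc

lemma simpleMatrix_bound {E : Type*} (f : SimpleFunc α ℂ) (φ : SimpleFunc β E)
    (T : Lp ℂ (ENNReal.ofReal p) μ →L[ℂ] Lp ℂ (ENNReal.ofReal q) ν) {M : ℝ} (hM : ‖T‖ ≤ M)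
    (a : ℂ → ℂ) :
    (∑ j ∈ φ.range, ν.real (φ ⁻¹' {j}) *
        ‖∑ i ∈ f.range, simpleMatrix f φ T j i * a i‖ ^ q) ^ q⁻¹ ≤
      M * (∑ i ∈ f.range, μ.real (f ⁻¹' {i}) * ‖a i‖ ^ p) ^ p⁻¹ := by
  rw [← norm_simpleFuncLM]
  refine le_trans ?_ (T.le_of_opNorm_le hM _)
  rw [Lp.norm_def, ← ENNReal.ofReal_le_iff_le_toReal (Lp.eLpNorm_ne_top _),
    ← eLpNorm_simpleAverage_simpleFuncLM f φ T a (ENNReal.one_le_ofReal.1 hq1.out)]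
  exact eLpNorm_simpleAverage_le φ (Lp.aestronglyMeasurable _) hq1.out ENNReal.ofReal_ne_top

/-- Two operators between `L^p` spaces are consistent if they agree on the common part of their
domains. -/
def ConsistentOnLp {P₀ P₁ Q₀ Q₁ : ℝ≥0∞} [Fact (1 ≤ P₀)] [Fact (1 ≤ P₁)] [Fact (1 ≤ Q₀)]
    [Fact (1 ≤ Q₁)] (T₀ : Lp ℂ P₀ μ →L[ℂ] Lp ℂ Q₀ ν) (T₁ : Lp ℂ P₁ μ →L[ℂ] Lp ℂ Q₁ ν) : Prop :=
  ∀ (f₀ : Lp ℂ P₀ μ) (f₁ : Lp ℂ P₁ μ), (f₀ : α → ℂ) =ᵐ[μ] f₁ → (T₀ f₀ : β → ℂ) =ᵐ[ν] T₁ f₁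

lemma ConsistentOnLp.simpleMatrix_eq {E : Type*}
    {T₀ : Lp ℂ (ENNReal.ofReal p₀) μ →L[ℂ] Lp ℂ (ENNReal.ofReal q₀) ν}
    {T₁ : Lp ℂ (ENNReal.ofReal p₁) μ →L[ℂ] Lp ℂ (ENNReal.ofReal q₁) ν}
    (hT : ConsistentOnLp T₀ T₁) (f : SimpleFunc α ℂ) (φ : SimpleFunc β E) :
    simpleMatrix f φ T₀ = simpleMatrix f φ T₁ := by
  ext j i
  simp only [simpleMatrix, setAverageLM_apply, setAverage_eq]
  rw [integral_congr_ae (ae_restrict_of_ae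
    (hT _ _ ((coeFn_simpleFuncLM f _).trans (coeFn_simpleFuncLM f _).symm)))]

/-- **Riesz–Thorin** on simple functions. -/
theorem ConsistentOnLp.eLpNorm_apply_simpleFunc_le
    {T₀ : Lp ℂ (ENNReal.ofReal p₀) μ →L[ℂ] Lp ℂ (ENNReal.ofReal q₀) ν}
    {T₁ : Lp ℂ (ENNReal.ofReal p₁) μ →L[ℂ] Lp ℂ (ENNReal.ofReal q₁) ν}
    (hT : ConsistentOnLp T₀ T₁) (hθ0 : 0 < θ) (hθ1 : θ < 1)
    (hp : 1 / p = (1 - θ) / p₀ + θ / p₁) (hq : 1 / q = (1 - θ) / q₀ + θ / q₁)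
    {M₀ M₁ : ℝ} (hM₀ : ‖T₀‖ ≤ M₀) (hM₁ : ‖T₁‖ ≤ M₁) {f : SimpleFunc α ℂ}
    (hf₀ : MemLp f (ENNReal.ofReal p₀) μ) :
    eLpNorm (T₀ (hf₀.toLp f)) (ENNReal.ofReal q) ν ≤
      ENNReal.ofReal (M₀ ^ (1 - θ) * M₁ ^ θ) * eLpNorm f (ENNReal.ofReal p) μ := by
  have hM₀' := (norm_nonneg _).trans hM₀
  have hM₁' := (norm_nonneg _).trans hM₁
  have one_le := fun {r : ℝ} (h : Fact (1 ≤ ENNReal.ofReal r)) ↦ ENNReal.one_le_ofReal.1 h.out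
  have ne_zero := fun {r : ℝ} (h : Fact (1 ≤ ENNReal.ofReal r)) ↦ (zero_lt_one.trans_le h.out).ne'
  have hfp : ∀ {r : ℝ} (h : Fact (1 ≤ ENNReal.ofReal r)), MemLp f (ENNReal.ofReal r) μ := fun h ↦
    memLp_simpleFunc_exponent _ (ne_zero hp₀) ENNReal.ofReal_ne_top (ne_zero h)
      ENNReal.ofReal_ne_top hf₀
  set C := M₀ ^ (1 - θ) * M₁ ^ θ with hC
  have hC0 : 0 ≤ C := by positivity
  have havg : ∀ {E : Type _} (φ : SimpleFunc β E),
      eLpNorm (simpleAverage φ ν (T₀ (hf₀.toLp f))) (ENNReal.ofReal q) ν ≤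
        ENNReal.ofReal C * eLpNorm f (ENNReal.ofReal p) μ := by
    intro E φ
    rw [← simpleFuncLM_id hf₀, eLpNorm_simpleAverage_simpleFuncLM f φ T₀ id (one_le hq1)]
    have hn : eLpNorm f (ENNReal.ofReal p) μ = ENNReal.ofReal
        ((∑ i ∈ f.range, μ.real (f ⁻¹' {i}) * ‖id i‖ ^ p) ^ p⁻¹) := by
      rw [← norm_simpleFuncLM, simpleFuncLM_id (hfp hp1), Lp.norm_toLp,
        ENNReal.ofReal_toReal (hfp hp1).eLpNorm_ne_top]
    rw [hn, ← ENNReal.ofReal_mul hC0]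
    refine ENNReal.ofReal_le_ofReal (matrix_riesz_thorin f.range φ.range _ _ _
      (fun _ ↦ measureReal_nonneg) (fun _ ↦ measureReal_nonneg) (one_le hp₀) (one_le hp₁)
      (one_le hq₀) (one_le hq₁) hθ0 hθ1 hp hq (one_le hp1) (one_le hq1) hM₀' hM₁'
      (simpleMatrix_bound f φ T₀ hM₀) ?_ id)
    rw [hT.simpleMatrix_eq]
    exact simpleMatrix_bound f φ T₁ hM₁
  have hTf : MemLp (T₀ (hf₀.toLp f)) (ENNReal.ofReal q) ν := by
    obtain ⟨hmin, hmax⟩ := min_le_and_le_max_of_one_div_eq (one_le hq₀) (one_le hq₁) (one_le hq1)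
      hθ0 hθ1 hq
    refine memLp_of_memLp_of_min_le_of_le_max (one_le hq₀) (one_le hq₁) hmin hmax (Lp.memLp _) ?_
    exact (memLp_congr_ae (hT _ _ (hf₀.coeFn_toLp.trans (hfp hp₁).coeFn_toLp.symm))).2
      (Lp.memLp (T₁ ((hfp hp₁).toLp f)))
  rw [← ENNReal.ofReal_toReal (hfp hp1).eLpNorm_ne_top, ← ENNReal.ofReal_mul hC0,
    ← ENNReal.ofReal_toReal hTf.eLpNorm_ne_top]
  refine ENNReal.ofReal_le_ofReal (le_of_forall_pos_le_add fun ε hε ↦ ?_)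
  obtain ⟨φ, hφ⟩ := exists_norm_sub_simpleAverageL_le ENNReal.ofReal_ne_top
    (fun _ : Unit ↦ hTf.toLp _) hε
  have hA : ‖simpleAverageL φ ν ENNReal.ofReal_ne_top (hTf.toLp _)‖ ≤
      C * (eLpNorm f (ENNReal.ofReal p) μ).toReal := by
    rw [simpleAverageL_apply, Lp.norm_toLp, simpleAverage_congr φ hTf.coeFn_toLp]
    refine ENNReal.toReal_le_of_le_ofReal (by positivity) ?_
    rw [ENNReal.ofReal_mul hC0, ENNReal.ofReal_toReal (hfp hp1).eLpNorm_ne_top]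
    exact havg φ
  rw [← Lp.norm_toLp _ hTf]
  linarith [norm_le_norm_add_norm_sub' (hTf.toLp _)
    (simpleAverageL φ ν ENNReal.ofReal_ne_top (hTf.toLp _)), hφ ()]

end SimpleFunctions

section Interpolation

open scoped ENNReal

variable {α β : Type*} [MeasurableSpace α] [MeasurableSpace β] {μ : Measure α} {ν : Measure β}

lemma ContinuousLinearMap.ext_of_toLp_simpleFunc {P : ℝ≥0∞} [Fact (1 ≤ P)] (hP : P ≠ ∞)
    {Y : Type*} [NormedAddCommGroup Y] [NormedSpace ℂ Y] {R S : Lp ℂ P μ →L[ℂ] Y}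
    (h : ∀ (f : SimpleFunc α ℂ) (hf : MemLp f P μ), R (hf.toLp f) = S (hf.toLp f)) : R = S := by
  refine DFunLike.coe_injective
    ((Lp.simpleFunc.denseRange hP).equalizer R.continuous S.continuous (funext fun g ↦ ?_))
  have := h (Lp.simpleFunc.toSimpleFunc g) (Lp.simpleFunc.memLp g)
  rwa [← Lp.simpleFunc.toLp_eq_toLp, Lp.simpleFunc.toLp_toSimpleFunc] at this

variable {p₀ p₁ q₀ q₁ p q θ : ℝ} [hp₀ : Fact (1 ≤ ENNReal.ofReal p₀)]
  [hp₁ : Fact (1 ≤ ENNReal.ofReal p₁)] [hq₀ : Fact (1 ≤ ENNReal.ofReal q₀)]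
  [hq₁ : Fact (1 ≤ ENNReal.ofReal q₁)] [hp1 : Fact (1 ≤ ENNReal.ofReal p)]
  [hq1 : Fact (1 ≤ ENNReal.ofReal q)]
  {T₀ : Lp ℂ (ENNReal.ofReal p₀) μ →L[ℂ] Lp ℂ (ENNReal.ofReal q₀) ν}
  {T₁ : Lp ℂ (ENNReal.ofReal p₁) μ →L[ℂ] Lp ℂ (ENNReal.ofReal q₁) ν}

/-- **Riesz–Thorin**: consistent operators extend to the interpolated spaces. -/
theorem ConsistentOnLp.exists_interpolant
    (hT : ConsistentOnLp T₀ T₁) (hθ0 : 0 < θ) (hθ1 : θ < 1)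
    (hp : 1 / p = (1 - θ) / p₀ + θ / p₁) (hq : 1 / q = (1 - θ) / q₀ + θ / q₁)
    {M₀ M₁ : ℝ} (hM₀ : ‖T₀‖ ≤ M₀) (hM₁ : ‖T₁‖ ≤ M₁) :
    ∃ S : Lp ℂ (ENNReal.ofReal p) μ →L[ℂ] Lp ℂ (ENNReal.ofReal q) ν,
      ‖S‖ ≤ M₀ ^ (1 - θ) * M₁ ^ θ ∧
      ∀ (f : SimpleFunc α ℂ) (hf : MemLp f (ENNReal.ofReal p) μ)
        (hf₀ : MemLp f (ENNReal.ofReal p₀) μ), S (hf.toLp f) =ᵐ[ν] T₀ (hf₀.toLp f) := by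
  set C := M₀ ^ (1 - θ) * M₁ ^ θ with hC
  have hC0 : 0 ≤ C := mul_nonneg (Real.rpow_nonneg ((norm_nonneg _).trans hM₀) _)
    (Real.rpow_nonneg ((norm_nonneg _).trans hM₁) _)
  let _ : Module ℂ (Lp.simpleFunc ℂ (ENNReal.ofReal p) μ) := Lp.simpleFunc.module
  have hmem : ∀ g : Lp.simpleFunc ℂ (ENNReal.ofReal p) μ,
      MemLp (Lp.simpleFunc.toSimpleFunc g) (ENNReal.ofReal p₀) μ := fun g ↦
    memLp_simpleFunc_exponent _ (zero_lt_one.trans_le hp1.out).ne' ENNReal.ofReal_ne_top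
      (zero_lt_one.trans_le hp₀.out).ne' ENNReal.ofReal_ne_top (Lp.simpleFunc.memLp g)
  have hbound := fun g : Lp.simpleFunc ℂ (ENNReal.ofReal p) μ ↦
    hT.eLpNorm_apply_simpleFunc_le (p := p) (q := q) hθ0 hθ1 hp hq hM₀ hM₁ (hmem g)
  have hmemT : ∀ g, MemLp (T₀ ((hmem g).toLp _)) (ENNReal.ofReal q) ν := fun g ↦
    ⟨Lp.aestronglyMeasurable _, (hbound g).trans_lt
      (ENNReal.mul_lt_top ENNReal.ofReal_lt_top (Lp.simpleFunc.memLp g).eLpNorm_lt_top)⟩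
  let e : Lp.simpleFunc ℂ (ENNReal.ofReal p) μ →ₗ[ℂ] Lp ℂ (ENNReal.ofReal p) μ :=
    { toFun := (↑), map_add' := fun _ _ ↦ rfl, map_smul' := fun _ _ ↦ rfl }
  let F : Lp.simpleFunc ℂ (ENNReal.ofReal p) μ →ₗ[ℂ] Lp ℂ (ENNReal.ofReal q) ν :=
    { toFun := fun g ↦ (hmemT g).toLp _
      map_add' := fun g h ↦ by
        rw [← MemLp.toLp_add]
        refine MemLp.toLp_congr _ _ ?_
        have : (hmem (g + h)).toLp _ = (hmem g).toLp _ + (hmem h).toLp _ := by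
          rw [← MemLp.toLp_add]
          exact MemLp.toLp_congr _ _ (Lp.simpleFunc.add_toSimpleFunc g h)
        rw [this, map_add]
        exact Lp.coeFn_add _ _
      map_smul' := fun c g ↦ by
        rw [RingHom.id_apply, ← MemLp.toLp_const_smul]
        refine MemLp.toLp_congr _ _ ?_
        have : (hmem (c • g)).toLp _ = c • (hmem g).toLp _ := by
          rw [← MemLp.toLp_const_smul]
          exact MemLp.toLp_congr _ _ (Lp.simpleFunc.smul_toSimpleFunc c g)
        rw [this, map_smul]
        exact Lp.coeFn_smul _ _ }
  have hdense : DenseRange e := Lp.simpleFunc.denseRange ENNReal.ofReal_ne_top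
  have hF : ∀ g, ‖F g‖ ≤ C * ‖e g‖ := fun g ↦ by
    have hg : ‖e g‖ = (eLpNorm (Lp.simpleFunc.toSimpleFunc g) (ENNReal.ofReal p) μ).toReal :=
      Lp.simpleFunc.norm_toSimpleFunc g
    rw [hg]
    refine (Lp.norm_toLp _ (hmemT g)).trans_le (ENNReal.toReal_le_of_le_ofReal (by positivity) ?_)
    rw [ENNReal.ofReal_mul hC0, ENNReal.ofReal_toReal (Lp.simpleFunc.memLp g).eLpNorm_ne_top]
    exact hbound g
  refine ⟨F.extendOfNorm e, LinearMap.opNorm_extendOfNorm_le hdense hC0 hF, fun f hf hf₀ ↦ ?_⟩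
  have hSf := LinearMap.extendOfNorm_eq hdense ⟨C, hF⟩ (f.toLp hf)
  change F.extendOfNorm e (hf.toLp f) = _ at hSf
  rw [hSf]
  refine (hmemT _).coeFn_toLp.trans ?_
  rw [MemLp.toLp_congr (hmem (f.toLp hf)) hf₀ (Lp.simpleFunc.toSimpleFunc_toLp f hf)]

/-- Operators that agree on simple functions agree on the common part of their domains. -/
lemma ConsistentOnLp.of_simpleFunc {S : Lp ℂ (ENNReal.ofReal p) μ →L[ℂ] Lp ℂ (ENNReal.ofReal q) ν}
    (hS : ∀ (f : SimpleFunc α ℂ) (hf : MemLp f (ENNReal.ofReal p) μ)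
      (hf₀ : MemLp f (ENNReal.ofReal p₀) μ), S (hf.toLp f) =ᵐ[ν] T₀ (hf₀.toLp f)) :
    ConsistentOnLp S T₀ := by
  intro f f₀ hff₀
  set g : α → ℂ := (Lp.aestronglyMeasurable f).mk f
  have hg : Measurable g := (Lp.aestronglyMeasurable f).stronglyMeasurable_mk.measurable
  have hfg : f =ᵐ[μ] g := (Lp.aestronglyMeasurable f).ae_eq_mk
  have hgp : MemLp g (ENNReal.ofReal p) μ := (memLp_congr_ae hfg).1 (Lp.memLp f)
  have hgp₀ : MemLp g (ENNReal.ofReal p₀) μ :=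
    (memLp_congr_ae (hff₀.symm.trans hfg)).1 (Lp.memLp f₀)
  have hf : hgp.toLp g = f := Lp.ext (hgp.coeFn_toLp.trans hfg.symm)
  have hf₀ : hgp₀.toLp g = f₀ := Lp.ext (hgp₀.coeFn_toLp.trans (hfg.symm.trans hff₀))
  have h := tendstoInMeasure_of_tendsto_Lp ((S.continuous.tendsto _).comp
    (SimpleFunc.tendsto_approxOn_range_Lp ENNReal.ofReal_ne_top hg hgp))
  have h₀ := tendstoInMeasure_of_tendsto_Lp ((T₀.continuous.tendsto _).comp
    (SimpleFunc.tendsto_approxOn_range_Lp ENNReal.ofReal_ne_top hg hgp₀))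
  rw [hf] at h
  rw [hf₀] at h₀
  exact tendstoInMeasure_ae_unique h (h₀.congr_left fun n ↦ (hS _ _ _).symm)

lemma coeFn_sub_simpleAverageL_comp_apply {E X : Type*} [NormedAddCommGroup X] [NormedSpace ℂ X]
    (φ : SimpleFunc β E) (T : X →L[ℂ] Lp ℂ (ENNReal.ofReal q) ν) (x : X) :
    (T - (simpleAverageL φ ν ENNReal.ofReal_ne_top).comp T) x =ᵐ[ν]
      ⇑(T x) - simpleAverage φ ν (T x) := by
  filter_upwards [Lp.coeFn_sub (T x) (simpleAverageL φ ν ENNReal.ofReal_ne_top (T x)),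
    coeFn_simpleAverageL ENNReal.ofReal_ne_top φ (T x)] with y h1 h2
  rw [sub_apply, ContinuousLinearMap.comp_apply, h1, Pi.sub_apply, h2, Pi.sub_apply]

lemma ConsistentOnLp.sub_simpleAverageL_comp {E : Type*} (hT : ConsistentOnLp T₀ T₁)
    (φ : SimpleFunc β E) :
    ConsistentOnLp (T₀ - (simpleAverageL φ ν ENNReal.ofReal_ne_top).comp T₀)
      (T₁ - (simpleAverageL φ ν ENNReal.ofReal_ne_top).comp T₁) := by
  intro f₀ f₁ hf
  refine (coeFn_sub_simpleAverageL_comp_apply φ T₀ f₀).trans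
    (.trans ?_ (coeFn_sub_simpleAverageL_comp_apply φ T₁ f₁).symm)
  rw [simpleAverage_congr φ (hT _ _ hf)]
  exact (hT _ _ hf).sub .rfl

/-- The interpolant of a compact operator and a bounded one is approximated in norm by compact
operators. -/
lemma ConsistentOnLp.exists_isCompactOperator_norm_sub_le (hT : ConsistentOnLp T₀ T₁)
    (hT₀ : IsCompactOperator T₀) (hθ0 : 0 < θ) (hθ1 : θ < 1)
    (hp : 1 / p = (1 - θ) / p₀ + θ / p₁) (hq : 1 / q = (1 - θ) / q₀ + θ / q₁)
    {S : Lp ℂ (ENNReal.ofReal p) μ →L[ℂ] Lp ℂ (ENNReal.ofReal q) ν}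
    (hS : ∀ (f : SimpleFunc α ℂ) (hf : MemLp f (ENNReal.ofReal p) μ)
      (hf₀ : MemLp f (ENNReal.ofReal p₀) μ), S (hf.toLp f) =ᵐ[ν] T₀ (hf₀.toLp f))
    {ε : ℝ} (hε : 0 < ε) :
    ∃ K : Lp ℂ (ENNReal.ofReal p) μ →L[ℂ] Lp ℂ (ENNReal.ofReal q) ν,
      IsCompactOperator K ∧ ‖K - S‖ ≤ ε ^ (1 - θ) * (2 * ‖T₁‖) ^ θ := by
  obtain ⟨s, φ, hφ⟩ := hT₀.exists_norm_sub_simpleAverageL_comp_le ENNReal.ofReal_ne_top hε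
  have hφ₁ : ‖T₁ - (simpleAverageL φ ν ENNReal.ofReal_ne_top).comp T₁‖ ≤ 2 * ‖T₁‖ := by
    refine ContinuousLinearMap.opNorm_le_bound _ (by positivity) fun x ↦ ?_
    have h1 := norm_sub_le (T₁ x) (simpleAverageL φ ν ENNReal.ofReal_ne_top (T₁ x))
    have h2 := norm_simpleAverageL_apply_le ENNReal.ofReal_ne_top φ (T₁ x)
    rw [sub_apply, ContinuousLinearMap.comp_apply]
    linarith [T₁.le_opNorm x]
  obtain ⟨R, hR, hRf⟩ := (hT.sub_simpleAverageL_comp φ).exists_interpolant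
    (p := p) (q := q) hθ0 hθ1 hp hq hφ hφ₁
  have hRS : R = S - (simpleAverageL φ ν ENNReal.ofReal_ne_top).comp S := by
    refine ContinuousLinearMap.ext_of_toLp_simpleFunc ENNReal.ofReal_ne_top fun f hf ↦ Lp.ext ?_
    have hf₀ : MemLp f (ENNReal.ofReal p₀) μ :=
      memLp_simpleFunc_exponent _ (zero_lt_one.trans_le hp1.out).ne' ENNReal.ofReal_ne_top
        (zero_lt_one.trans_le hp₀.out).ne' ENNReal.ofReal_ne_top hf
    refine ((hRf f hf hf₀).trans (coeFn_sub_simpleAverageL_comp_apply φ T₀ _)).trans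
      (.trans ?_ (coeFn_sub_simpleAverageL_comp_apply φ S _).symm)
    rw [simpleAverage_congr φ (hS f hf hf₀)]
    exact (hS f hf hf₀).symm.sub .rfl
  refine ⟨(simpleAverageL φ ν ENNReal.ofReal_ne_top).comp S, ?_, ?_⟩
  · exact (isCompactOperator_simpleAverageL ENNReal.ofReal_ne_top φ).comp_clm S
  · rwa [norm_sub_rev, ← hRS]

/-- One-sided compactness is inherited by the interpolant. -/
theorem ConsistentOnLp.isCompactOperator_interpolant (hT : ConsistentOnLp T₀ T₁)
    (hT₀ : IsCompactOperator T₀) (hθ0 : 0 < θ) (hθ1 : θ < 1)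
    (hp : 1 / p = (1 - θ) / p₀ + θ / p₁) (hq : 1 / q = (1 - θ) / q₀ + θ / q₁)
    {S : Lp ℂ (ENNReal.ofReal p) μ →L[ℂ] Lp ℂ (ENNReal.ofReal q) ν}
    (hS : ∀ (f : SimpleFunc α ℂ) (hf : MemLp f (ENNReal.ofReal p) μ)
      (hf₀ : MemLp f (ENNReal.ofReal p₀) μ), S (hf.toLp f) =ᵐ[ν] T₀ (hf₀.toLp f)) :
    IsCompactOperator S := by
  choose K hK hKS using fun n : ℕ ↦ hT.exists_isCompactOperator_norm_sub_le hT₀ hθ0 hθ1 hp hq hS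
    (Nat.one_div_pos_of_nat (α := ℝ) (n := n))
  refine isCompactOperator_of_tendsto (l := atTop) (F := K) ?_ (Eventually.of_forall hK)
  rw [tendsto_iff_norm_sub_tendsto_zero]
  refine squeeze_zero (fun n ↦ norm_nonneg _) hKS ?_
  have h := (tendsto_one_div_add_atTop_nhds_zero_nat (𝕜 := ℝ)).rpow_const (p := 1 - θ)
    (Or.inr (by linarith))
  rw [Real.zero_rpow (by linarith)] at h
  simpa using h.mul_const ((2 * ‖T₁‖) ^ θ)

end Interpolation

theorem stmt15 {α β : Type*} [MeasurableSpace α] [MeasurableSpace β]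
    (μ : Measure α) (ν : Measure β) [SigmaFinite μ] [SigmaFinite ν]
    (p₀ p₁ q₀ q₁ p q θ : ℝ)
    (hp₀ : 1 ≤ p₀) (hp₁ : 1 ≤ p₁) (hq₀ : 1 ≤ q₀) (hq₁ : 1 ≤ q₁)
    (hθ0 : 0 < θ) (hθ1 : θ < 1)
    (hp : 1 / p = (1 - θ) / p₀ + θ / p₁)
    (hq : 1 / q = (1 - θ) / q₀ + θ / q₁)
    (hp1 : 1 ≤ p) (hq1 : 1 ≤ q) :
    haveI : Fact ((1:ENNReal) ≤ ENNReal.ofReal p₀) := ⟨ENNReal.one_le_ofReal.mpr hp₀⟩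
    haveI : Fact ((1:ENNReal) ≤ ENNReal.ofReal p₁) := ⟨ENNReal.one_le_ofReal.mpr hp₁⟩
    haveI : Fact ((1:ENNReal) ≤ ENNReal.ofReal q₀) := ⟨ENNReal.one_le_ofReal.mpr hq₀⟩
    haveI : Fact ((1:ENNReal) ≤ ENNReal.ofReal q₁) := ⟨ENNReal.one_le_ofReal.mpr hq₁⟩
    haveI : Fact ((1:ENNReal) ≤ ENNReal.ofReal p) := ⟨ENNReal.one_le_ofReal.mpr hp1⟩
    haveI : Fact ((1:ENNReal) ≤ ENNReal.ofReal q) := ⟨ENNReal.one_le_ofReal.mpr hq1⟩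
    ∀ (T₀ : Lp ℂ (ENNReal.ofReal p₀) μ →L[ℂ] Lp ℂ (ENNReal.ofReal q₀) ν)
      (T₁ : Lp ℂ (ENNReal.ofReal p₁) μ →L[ℂ] Lp ℂ (ENNReal.ofReal q₁) ν),
      IsCompactOperator T₀ →
      (∀ (f₀ : Lp ℂ (ENNReal.ofReal p₀) μ) (f₁ : Lp ℂ (ENNReal.ofReal p₁) μ),
        (f₀ : α → ℂ) =ᵐ[μ] (f₁ : α → ℂ) → (T₀ f₀ : β → ℂ) =ᵐ[ν] (T₁ f₁ : β → ℂ)) →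
      ∃ S : Lp ℂ (ENNReal.ofReal p) μ →L[ℂ] Lp ℂ (ENNReal.ofReal q) ν,
        IsCompactOperator S ∧
        ∀ (f : Lp ℂ (ENNReal.ofReal p) μ) (f₀ : Lp ℂ (ENNReal.ofReal p₀) μ)
          (f₁ : Lp ℂ (ENNReal.ofReal p₁) μ),
          (f : α → ℂ) =ᵐ[μ] (f₀ : α → ℂ) → (f : α → ℂ) =ᵐ[μ] (f₁ : α → ℂ) →
          (S f : β → ℂ) =ᵐ[ν] (T₀ f₀ : β → ℂ) := by
  have : Fact (1 ≤ ENNReal.ofReal p₀) := ⟨ENNReal.one_le_ofReal.2 hp₀⟩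
  have : Fact (1 ≤ ENNReal.ofReal p₁) := ⟨ENNReal.one_le_ofReal.2 hp₁⟩
  have : Fact (1 ≤ ENNReal.ofReal q₀) := ⟨ENNReal.one_le_ofReal.2 hq₀⟩
  have : Fact (1 ≤ ENNReal.ofReal q₁) := ⟨ENNReal.one_le_ofReal.2 hq₁⟩
  have : Fact (1 ≤ ENNReal.ofReal p) := ⟨ENNReal.one_le_ofReal.2 hp1⟩
  have : Fact (1 ≤ ENNReal.ofReal q) := ⟨ENNReal.one_le_ofReal.2 hq1⟩
  intro T₀ T₁ hT₀ hT
  have hT : ConsistentOnLp T₀ T₁ := hT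
  obtain ⟨S, -, hS⟩ := hT.exists_interpolant (p := p) (q := q) hθ0 hθ1 hp hq le_rfl le_rfl
  exact ⟨S, hT.isCompactOperator_interpolant hT₀ hθ0 hθ1 hp hq hS,
    fun f f₀ _ hf₀ _ ↦ ConsistentOnLp.of_simpleFunc hS f f₀ hf₀⟩
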